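/- arXiv:1208.3187 — 2 statements merged into one kernel-verified Lean document; each statement's English description precedes it below -/
import Mathlib

section
/- Let (Ωₙ, Fₙ, Pₙ), n ∈ ℕ, be probability spaces and let (Ω, F, P) be their countable product (Ω = ∏ₙ Ωₙ with the product σ-algebra and the infinite product probability measure). For each n let Ψₙ : Ωₙ → ℝ be an arbitrary function, and define Xₙ(ω) = Ψₙ(ωₙ) on Ω. Let (Ψₙ)_* and (Ψₙ)^* be a maximal measurable minorant and a minimal measurable majorant of Ψₙ with respect to Pₙ, and set Yₙ(ω) = (Ψₙ)_*(ωₙ) and Zₙ(ω) = (Ψₙ)^*(ωₙ). Then Yₙ is a maximal measurable minorant of Xₙ with respect to P and Zₙ is a minimal measurable majorant of Xₙ with respect to P; that is, Yₙ and Zₙ are P-measurable with Yₙ ≤ Xₙ ≤ Zₙ everywhere, every P-measurable g ≤ Xₙ satisfies g ≤ Yₙ P-almost surely, and every P-measurable h ≥ Xₙ satisfies h ≥ Zₙ P-almost surely. -/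
open MeasureTheory Filter

/-- `flow` is a maximal measurable minorant of `f` with respect to the measure `P`. -/
def IsMeasMinorant {Ω : Type*} [MeasurableSpace Ω] (P : Measure Ω) (f flow : Ω → ℝ) : Prop :=
  Measurable flow ∧ (∀ ω, flow ω ≤ f ω) ∧
    ∀ g : Ω → ℝ, Measurable g → (∀ ω, g ω ≤ f ω) → ∀ᵐ ω ∂P, g ω ≤ flow ω

/-- `fup` is a minimal measurable majorant of `f` with respect to the measure `P`. -/
def IsMeasMajorant {Ω : Type*} [MeasurableSpace Ω] (P : Measure Ω) (f fup : Ω → ℝ) : Prop :=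
  Measurable fup ∧ (∀ ω, f ω ≤ fup ω) ∧
    ∀ h : Ω → ℝ, Measurable h → (∀ ω, f ω ≤ h ω) → ∀ᵐ ω ∂P, h ω ≥ fup ω

/-- Resampling one coordinate of an infinite product independently preserves the measure. -/
lemma measurePreserving_update_infinitePi {ι : Type*} [DecidableEq ι] {X : ι → Type*}
    [∀ i, MeasurableSpace (X i)] (μ : ∀ i, Measure (X i)) [∀ i, IsProbabilityMeasure (μ i)]
    (i : ι) :
    MeasurePreserving (fun p : (∀ j, X j) × X i => Function.update p.1 i p.2)
      ((Measure.infinitePi μ).prod (μ i)) (Measure.infinitePi μ) := by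
  have hm : Measurable (fun p : (∀ j, X j) × X i => Function.update p.1 i p.2) :=
    measurable_update'
  refine ⟨hm, Measure.eq_infinitePi μ fun s t ht => ?_⟩
  rw [Measure.map_apply hm (MeasurableSet.pi s.countable_toSet fun j _ => ht j)]
  by_cases hi : i ∈ s
  · have hpre : (fun p : (∀ j, X j) × X i => Function.update p.1 i p.2) ⁻¹' (s : Set ι).pi t =
        ((s.erase i : Finset ι) : Set ι).pi t ×ˢ t i := by
      ext ⟨ω, x⟩
      simp only [Set.mem_preimage, Set.mem_prod, Set.update_mem_pi_iff, Finset.coe_erase,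
        Finset.mem_coe, hi, forall_const]
    rw [hpre, Measure.prod_prod, Measure.infinitePi_pi μ fun j _ => ht j,
      Finset.prod_erase_mul _ _ hi]
  · have hpre : (fun p : (∀ j, X j) × X i => Function.update p.1 i p.2) ⁻¹' (s : Set ι).pi t =
        (s : Set ι).pi t ×ˢ Set.univ := by
      ext ⟨ω, x⟩
      simp only [Set.mem_preimage, Set.mem_prod, Set.update_mem_pi_iff, Finset.mem_coe, hi,
        Set.sdiff_singleton_eq_self (Finset.mem_coe.not.2 hi), Set.mem_univ, false_imp_iff]
    rw [hpre, Measure.prod_prod, Measure.infinitePi_pi μ fun j _ => ht j, measure_univ, mul_one]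

/-- A measurable property holds almost surely on an infinite product if it holds almost surely
in one coordinate whenever the other coordinates are fixed. -/
lemma ae_infinitePi_of_forall_ae_update {ι : Type*} [DecidableEq ι] {X : ι → Type*}
    [∀ i, MeasurableSpace (X i)] (μ : ∀ i, Measure (X i)) [∀ i, IsProbabilityMeasure (μ i)]
    (i : ι) {p : (∀ j, X j) → Prop} (hp : MeasurableSet {ω | p ω})
    (h : ∀ ω, ∀ᵐ x ∂μ i, p (Function.update ω i x)) :
    ∀ᵐ ω ∂Measure.infinitePi μ, p ω := by
  have hmp := measurePreserving_update_infinitePi μ i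
  rw [← hmp.map_eq, ae_map_iff hmp.measurable.aemeasurable hp]
  exact (Measure.ae_prod_iff_ae_ae (hmp.measurable hp)).2 (ae_of_all _ h)

/-- **Minorants and majorants on a countable product.** If `(Ω, F, P)` is the countable product
of the probability spaces `(Ωₙ, Fₙ, Pₙ)`, `Ψₙ : Ωₙ → ℝ` is arbitrary, `Xₙ ω = Ψₙ (ω n)`,
and `(Ψₙ)_*`, `(Ψₙ)^*` are a maximal measurable minorant and a minimal measurable majorant of
`Ψₙ` w.r.t. `Pₙ`, then `Yₙ ω = (Ψₙ)_* (ω n)` and `Zₙ ω = (Ψₙ)^* (ω n)` are a maximal measurable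
minorant and a minimal measurable majorant of `Xₙ` w.r.t. `P`. -/
theorem minorant_majorant_product
    {Ω₁ : ℕ → Type*} [∀ n, MeasurableSpace (Ω₁ n)]
    (P₁ : ∀ n, Measure (Ω₁ n)) [∀ n, IsProbabilityMeasure (P₁ n)]
    (P : Measure (∀ n, Ω₁ n)) [IsProbabilityMeasure P]
    (hP : IsProjectiveLimit P (fun J : Finset ℕ => Measure.pi (fun j : J => P₁ j)))
    (Ψ Ψlow Ψup : ∀ n, Ω₁ n → ℝ)
    (hΨlow : ∀ n, IsMeasMinorant (P₁ n) (Ψ n) (Ψlow n))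
    (hΨup : ∀ n, IsMeasMajorant (P₁ n) (Ψ n) (Ψup n))
    (n : ℕ) :
    IsMeasMinorant P (fun ω => Ψ n (ω n)) (fun ω => Ψlow n (ω n)) ∧
    IsMeasMajorant P (fun ω => Ψ n (ω n)) (fun ω => Ψup n (ω n)) := by
  obtain rfl : P = Measure.infinitePi P₁ :=
    hP.unique (Measure.isProjectiveLimit_infinitePi P₁)
  obtain ⟨hlm, hle, hlmax⟩ := hΨlow n
  obtain ⟨hum, hue, humin⟩ := hΨup n
  have hlm' : Measurable fun ω : ∀ n, Ω₁ n => Ψlow n (ω n) := hlm.comp (measurable_pi_apply n)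
  have hum' : Measurable fun ω : ∀ n, Ω₁ n => Ψup n (ω n) := hum.comp (measurable_pi_apply n)
  refine ⟨⟨hlm', fun ω => hle _, fun g hg hgle => ?_⟩, ⟨hum', fun ω => hue _, fun h hh hle_h => ?_⟩⟩
  · refine ae_infinitePi_of_forall_ae_update P₁ n (measurableSet_le hg hlm') fun ω => ?_
    simpa using hlmax (fun x => g (Function.update ω n x)) (hg.comp (measurable_update ω))
      fun x => by simpa using hgle (Function.update ω n x)
  · refine ae_infinitePi_of_forall_ae_update P₁ n (measurableSet_le hum' hh) fun ω => ?_
    simpa using humin (fun x => h (Function.update ω n x)) (hh.comp (measurable_update ω))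
      fun x => by simpa using hle_h (Function.update ω n x)
end

section
/- Let (Ω, F, P) be a probability space, A ⊆ Ω an arbitrary subset, and α a real number with P_*(A) ≤ α ≤ P^*(A), where P_*(A) = sup{P(B) : B ∈ F, B ⊆ A} and P^*(A) = inf{P(B) : B ∈ F, A ⊆ B}. Then there exists a σ-algebra F' on Ω with F ⊆ F' and A ∈ F', and a probability measure Q on (Ω, F') such that Q(E) = P(E) for every E ∈ F and Q(A) = α. -/
open MeasureTheory ENNReal

/-- If `S` is contained in `A` or disjoint from `A`, then `A` and all measurable sets are
Carathéodory-measurable for the restriction to `S` of the outer measure of `P`. -/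
theorem sup_generateFrom_le_caratheodory_restrict {Ω : Type*} [F : MeasurableSpace Ω]
    (P : Measure Ω) {A S : Set Ω} (hS : S ⊆ A ∨ S ⊆ Aᶜ) :
    F ⊔ MeasurableSpace.generateFrom {A} ≤
      (OuterMeasure.restrict S P.toOuterMeasure).caratheodory := by
  refine sup_le ?_ (MeasurableSpace.generateFrom_singleton_le ?_)
  · intro E hE
    rw [OuterMeasure.isCaratheodory_iff]
    intro t
    simp only [OuterMeasure.restrict_apply, Measure.coe_toOuterMeasure]
    rw [← measure_inter_add_sdiff (t ∩ S) hE, Set.inter_right_comm t S E,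
      Set.inter_sdiff_right_comm]
  · change OuterMeasure.IsCaratheodory _ A
    intro t
    simp only [OuterMeasure.restrict_apply, Measure.coe_toOuterMeasure]
    rcases hS with h | h
    · have h₁ : t ∩ A ∩ S = t ∩ S := by grind
      have h₂ : (t \ A) ∩ S = ∅ := by grind
      simp [h₁, h₂]
    · have h₁ : t ∩ A ∩ S = ∅ := by grind
      have h₂ : (t \ A) ∩ S = t ∩ S := by grind
      simp [h₁, h₂]

/-- If `S` is contained in `A` or disjoint from `A`, then `E ↦ P (E ∩ S)` is a measure on the
σ-algebra obtained by adjoining `A`. -/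
theorem exists_measure_eq_measure_inter {Ω : Type*} {F' : MeasurableSpace Ω}
    [F : MeasurableSpace Ω] (P : Measure Ω) {A S : Set Ω}
    (hF' : F' ≤ F ⊔ MeasurableSpace.generateFrom {A}) (hS : S ⊆ A ∨ S ⊆ Aᶜ) :
    ∃ Q : @Measure Ω F', ∀ E : Set Ω, MeasurableSet[F'] E → Q E = P (E ∩ S) := by
  refine ⟨@OuterMeasure.toMeasure Ω F' (OuterMeasure.restrict S P.toOuterMeasure)
    (hF'.trans (sup_generateFrom_le_caratheodory_restrict P hS)), fun E hE => ?_⟩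
  rw [@toMeasure_apply Ω F' _ _ E hE, OuterMeasure.restrict_apply, Measure.coe_toOuterMeasure]

/-- A measure extends to the σ-algebra generated by its σ-algebra and one more set `A`, in such a
way that the extension gives `A` its outer measure. -/
theorem exists_extension_measure_eq_outer {Ω : Type*} {F' : MeasurableSpace Ω}
    [F : MeasurableSpace Ω] (P : Measure Ω) [IsFiniteMeasure P] (A : Set Ω) (hle : F ≤ F')
    (hF' : F' ≤ F ⊔ MeasurableSpace.generateFrom {A}) (hA : MeasurableSet[F'] A) :
    ∃ Q : @Measure Ω F', (∀ E : Set Ω, MeasurableSet[F] E → Q E = P E) ∧ Q A = P A := by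
  set H := toMeasurable P A
  have hAH : A ⊆ H := subset_toMeasurable P A
  have hdisj : A ∩ Hᶜ = ∅ := by grind
  obtain ⟨Q₁, hQ₁⟩ := exists_measure_eq_measure_inter P hF' (Or.inl subset_rfl)
  obtain ⟨Q₂, hQ₂⟩ := exists_measure_eq_measure_inter P hF'
    (Or.inr (Set.compl_subset_compl.2 hAH))
  refine ⟨Q₁ + Q₂, fun E hE => ?_, ?_⟩
  · rw [Measure.add_apply, hQ₁ E (hle _ hE), hQ₂ E (hle _ hE), Set.inter_comm E A,
      ← Measure.measure_toMeasurable_inter hE (measure_ne_top P A), Set.inter_comm _ E,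
      ← Set.sdiff_eq]
    exact measure_inter_add_sdiff E (measurableSet_toMeasurable P A)
  · simp [hQ₁ A hA, hQ₂ A hA, hdisj]

/-- **Extension of a probability measure measuring a given set.** If `A ⊆ Ω` and
`α` lies between the inner and outer probabilities of `A`, then `P` extends to a
probability measure `Q` on a larger σ-algebra containing `A` with `Q A = α`. -/
theorem exists_extension_measure_eq
    {Ω : Type*} [F : MeasurableSpace Ω] (P : Measure Ω) [IsProbabilityMeasure P]
    (A : Set Ω) (α : ℝ≥0∞)
    (h₁ : (⨆ (B : Set Ω) (_ : MeasurableSet B ∧ B ⊆ A), P B) ≤ α)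
    (h₂ : α ≤ ⨅ (B : Set Ω) (_ : MeasurableSet B ∧ A ⊆ B), P B) :
    ∃ F' : MeasurableSpace Ω, F ≤ F' ∧ MeasurableSet[F'] A ∧
      ∃ Q : @Measure Ω F', IsProbabilityMeasure Q ∧
        (∀ E : Set Ω, MeasurableSet[F] E → Q E = P E) ∧ Q A = α := by
  have hα : α ≤ P A := by
    rw [← measure_toMeasurable A]
    exact h₂.trans (iInf₂_le _ ⟨measurableSet_toMeasurable P A, subset_toMeasurable P A⟩)
  have hα' : α ≠ ∞ := ne_top_of_le_ne_top (measure_ne_top P A) hα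
  have hle : F ≤ F ⊔ MeasurableSpace.generateFrom {A} := le_sup_left
  have hA : MeasurableSet[F ⊔ MeasurableSpace.generateFrom {A}] A :=
    (le_sup_right : _ ≤ F ⊔ MeasurableSpace.generateFrom {A}) _
      (MeasurableSpace.measurableSet_generateFrom rfl)
  have hF' : F ⊔ MeasurableSpace.generateFrom {A} ≤ F ⊔ MeasurableSpace.generateFrom {Aᶜ} := by
    refine sup_le le_sup_left (MeasurableSpace.generateFrom_singleton_le ?_)
    exact .of_compl ((le_sup_right : _ ≤ F ⊔ MeasurableSpace.generateFrom {Aᶜ}) _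
      (MeasurableSpace.measurableSet_generateFrom rfl))
  obtain ⟨Q₁, hQ₁, hQ₁A⟩ := exists_extension_measure_eq_outer P A hle le_rfl hA
  obtain ⟨Q₂, hQ₂, hQ₂A⟩ := exists_extension_measure_eq_outer P Aᶜ hle hF' hA.compl
  have hQ₂prob : IsProbabilityMeasure Q₂ := ⟨by rw [hQ₂ _ .univ, measure_univ]⟩
  have hQ₂α : Q₂ A ≤ α := by
    have hB : MeasurableSet (toMeasurable P Aᶜ) := measurableSet_toMeasurable P Aᶜ
    have hQB : Q₂ A = P (toMeasurable P Aᶜ)ᶜ := by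
      have h := prob_compl_eq_one_sub (μ := Q₂) hA.compl
      rw [compl_compl] at h
      rw [h, hQ₂A, prob_compl_eq_one_sub hB, measure_toMeasurable]
    rw [hQB]
    exact (le_iSup₂ (f := fun (B : Set Ω) (_ : MeasurableSet B ∧ B ⊆ A) => P B) _
      ⟨hB.compl, Set.compl_subset_comm.1 (subset_toMeasurable P Aᶜ)⟩).trans h₁
  obtain ⟨a, b, ha, hb, hab, habα⟩ : α.toReal ∈ segment ℝ (Q₂ A).toReal (P A).toReal :=
    Icc_subset_segment ⟨toReal_mono hα' hQ₂α, toReal_mono (measure_ne_top P A) hα⟩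
  have hab' : ENNReal.ofReal a + ENNReal.ofReal b = 1 := by
    rw [← ofReal_add ha hb, hab, ofReal_one]
  have hQ : ∀ E : Set Ω, MeasurableSet[F] E →
      (ENNReal.ofReal a • Q₂ + ENNReal.ofReal b • Q₁) E = P E := by
    intro E hE
    simp [hQ₁ E hE, hQ₂ E hE, ← add_mul, hab']
  refine ⟨_, hle, hA, ENNReal.ofReal a • Q₂ + ENNReal.ofReal b • Q₁,
    ⟨by rw [hQ _ .univ, measure_univ]⟩, hQ, ?_⟩
  rw [Measure.add_apply, Measure.smul_apply, Measure.smul_apply, hQ₁A, smul_eq_mul, smul_eq_mul,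
    ← ofReal_toReal (measure_ne_top Q₂ A), ← ofReal_toReal (measure_ne_top P A),
    ← ofReal_mul ha, ← ofReal_mul hb, ← ofReal_add (by positivity) (by positivity),
    ← ofReal_toReal hα', ← habα, smul_eq_mul, smul_eq_mul]
end
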